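/- Let N(ρ) = Σ_{P,P' ∈ {𝟙,X,Y,Z}} a_{P,P'} (P⊗P') ρ (P⊗P')† be a two-qubit Pauli channel with nonnegative coefficients a_{P,P'} summing to 1. Let T(ρ) := (1/36) Σ_{B,B' ∈ 𝓑} (B⊗B')† N((B⊗B') ρ (B⊗B')†) (B⊗B') be the localized Clifford twirl of N on both qubits. Then T = N', where N'(ρ) = Σ_{P,P'} a'_{P,P'} (P⊗P') ρ (P⊗P')† with a'_{𝟙,𝟙} = a_{𝟙,𝟙}; a'_{P,𝟙} = (1/3) Σ_{R ∈ {X,Y,Z}} a_{R,𝟙} for each P ∈ {X,Y,Z}; a'_{𝟙,P'} = (1/3) Σ_{R' ∈ {X,Y,Z}} a_{𝟙,R'} for each P' ∈ {X,Y,Z}; and a'_{P,P'} = (1/9) Σ_{R,R' ∈ {X,Y,Z}} a_{R,R'} for each P,P' ∈ {X,Y,Z}. -/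

import Mathlib

open Matrix Kronecker

/-- The four Pauli matrices `𝟙, X, Y, Z`. -/
noncomputable def pauli : Fin 4 → Matrix (Fin 2) (Fin 2) ℂ
  | 0 => !![1, 0; 0, 1]
  | 1 => !![0, 1; 1, 0]
  | 2 => !![0, -Complex.I; Complex.I, 0]
  | 3 => !![1, 0; 0, -1]

/-- `H_{τ₁,τ₂} = (τ₁ + τ₂)/√2`. -/
noncomputable def Hmat (a b : Matrix (Fin 2) (Fin 2) ℂ) : Matrix (Fin 2) (Fin 2) ℂ :=
  ((Real.sqrt 2 : ℂ))⁻¹ • (a + b)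

/-- The six unitaries `𝓑 = {𝟙, H_{X,Y}, H_{X,Z}, H_{Y,Z}, H_{X,Z}H_{X,Y}, H_{X,Y}H_{X,Z}}`. -/
noncomputable def Bset : Fin 6 → Matrix (Fin 2) (Fin 2) ℂ :=
  ![1, Hmat (pauli 1) (pauli 2), Hmat (pauli 1) (pauli 3), Hmat (pauli 2) (pauli 3),
    Hmat (pauli 1) (pauli 3) * Hmat (pauli 1) (pauli 2),
    Hmat (pauli 1) (pauli 2) * Hmat (pauli 1) (pauli 3)]

/-- The two-qubit Pauli channel with coefficients `a`. -/
noncomputable def pauliChannel (a : Fin 4 → Fin 4 → ℝ)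
    (ρ : Matrix (Fin 2 × Fin 2) (Fin 2 × Fin 2) ℂ) :
    Matrix (Fin 2 × Fin 2) (Fin 2 × Fin 2) ℂ :=
  ∑ p : Fin 4, ∑ q : Fin 4, (a p q : ℂ) •
    ((pauli p ⊗ₖ pauli q) * ρ * (pauli p ⊗ₖ pauli q)ᴴ)

/-- The coefficients `a'` of the localized Clifford twirl of the Pauli channel. -/
noncomputable def twirledCoef (a : Fin 4 → Fin 4 → ℝ) (p q : Fin 4) : ℝ :=
  if p = 0 then
    (if q = 0 then a 0 0 else (a 0 1 + a 0 2 + a 0 3) / 3)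
  else if q = 0 then (a 1 0 + a 2 0 + a 3 0) / 3
  else (a 1 1 + a 1 2 + a 1 3 + a 2 1 + a 2 2 + a 2 3 + a 3 1 + a 3 2 + a 3 3) / 9

/-- Conjugation by `B` sends each Pauli matrix `P` to `f P`, up to a phase. -/
def PermutesPaulis (B : Matrix (Fin 2) (Fin 2) ℂ) (f : Equiv.Perm (Fin 4)) : Prop :=
  ∀ p, ∃ s : ℂ, s * star s = 1 ∧ Bᴴ * pauli p * B = s • pauli (f p)

theorem PermutesPaulis.one : PermutesPaulis 1 1 := fun p => ⟨1, by simp, by simp⟩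

theorem PermutesPaulis.mul {B C : Matrix (Fin 2) (Fin 2) ℂ} {f g : Equiv.Perm (Fin 4)}
    (hB : PermutesPaulis B f) (hC : PermutesPaulis C g) : PermutesPaulis (B * C) (g * f) := by
  intro p
  obtain ⟨s, hs, hsB⟩ := hB p
  obtain ⟨t, ht, htC⟩ := hC (f p)
  refine ⟨s * t, ?_, ?_⟩
  · rw [star_mul', mul_mul_mul_comm, hs, ht, one_mul]
  · calc (B * C)ᴴ * pauli p * (B * C) = Cᴴ * (Bᴴ * pauli p * B) * C := by
          simp only [conjTranspose_mul, Matrix.mul_assoc]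
      _ = (s * t) • pauli ((g * f) p) := by
          rw [hsB, Matrix.mul_smul, Matrix.smul_mul, htC, smul_smul, Equiv.Perm.mul_apply]

theorem pauli_conjTranspose (p : Fin 4) : (pauli p)ᴴ = pauli p := by
  fin_cases p <;> ext i j <;> fin_cases i <;> fin_cases j <;> simp [pauli]

theorem Hmat_conj (a b p : Fin 4) :
    (Hmat (pauli a) (pauli b))ᴴ * pauli p * Hmat (pauli a) (pauli b) =
      (2 : ℂ)⁻¹ • ((pauli a + pauli b) * pauli p * (pauli a + pauli b)) := by
  have h : ((Real.sqrt 2 : ℂ))⁻¹ * ((Real.sqrt 2 : ℂ))⁻¹ = 2⁻¹ := by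
    rw [← mul_inv, ← Complex.ofReal_mul, Real.mul_self_sqrt (by norm_num)]
    norm_num
  simp [Hmat, conjTranspose_smul, pauli_conjTranspose, smul_smul, h, -smul_add]

theorem PermutesPaulis.swap {a b : Fin 4} (ha : a ≠ 0) (hb : b ≠ 0) (hab : a ≠ b) :
    PermutesPaulis (Hmat (pauli a) (pauli b)) (Equiv.swap a b) := by
  intro p
  refine ⟨if p = 0 ∨ p = a ∨ p = b then 1 else -1, by split_ifs <;> simp, ?_⟩
  rw [Hmat_conj]
  have hI := Complex.I_mul_I
  fin_cases a <;> fin_cases b <;> first | contradiction | skip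
  all_goals
    fin_cases p <;> ext i j <;> fin_cases i <;> fin_cases j <;>
      simp [pauli, Equiv.swap_apply_def] <;>
      grind

/-- The permutation of the Pauli matrices realized by conjugation by each element of `Bset`. -/
def pauliPerm : Fin 6 → Equiv.Perm (Fin 4) :=
  ![1, Equiv.swap 1 2, Equiv.swap 1 3, Equiv.swap 2 3,
    Equiv.swap 1 2 * Equiv.swap 1 3, Equiv.swap 1 3 * Equiv.swap 1 2]

theorem permutesPaulis_Bset (i : Fin 6) : PermutesPaulis (Bset i) (pauliPerm i) := by
  have h12 : PermutesPaulis (Hmat (pauli 1) (pauli 2)) (Equiv.swap 1 2) :=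
    .swap (by decide) (by decide) (by decide)
  have h13 : PermutesPaulis (Hmat (pauli 1) (pauli 3)) (Equiv.swap 1 3) :=
    .swap (by decide) (by decide) (by decide)
  have h23 : PermutesPaulis (Hmat (pauli 2) (pauli 3)) (Equiv.swap 2 3) :=
    .swap (by decide) (by decide) (by decide)
  fin_cases i
  exacts [.one, h12, h13, h23, h13.mul h12, h12.mul h13]

theorem sum_pauliPerm {M : Type*} [AddCommGroup M] [Module ℂ M] (f : Fin 4 → M) (p : Fin 4) :
    ∑ i, f (pauliPerm i p) =
      if p = 0 then (6 : ℂ) • f 0 else (2 : ℂ) • (f 1 + f 2 + f 3) := by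
  fin_cases p <;> simp [Fin.sum_univ_succ, pauliPerm, Equiv.swap_apply_def] <;> module

/-- Conjugating a Pauli channel by `B ⊗ C` permutes its Kraus operators. -/
theorem PermutesPaulis.conj_pauliChannel {B C : Matrix (Fin 2) (Fin 2) ℂ}
    {f g : Equiv.Perm (Fin 4)} (hB : PermutesPaulis B f) (hC : PermutesPaulis C g)
    (a : Fin 4 → Fin 4 → ℝ) (ρ : Matrix (Fin 2 × Fin 2) (Fin 2 × Fin 2) ℂ) :
    (B ⊗ₖ C)ᴴ * pauliChannel a ((B ⊗ₖ C) * ρ * (B ⊗ₖ C)ᴴ) * (B ⊗ₖ C) =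
      ∑ p, ∑ q, (a p q : ℂ) •
        ((pauli (f p) ⊗ₖ pauli (g q)) * ρ * (pauli (f p) ⊗ₖ pauli (g q))ᴴ) := by
  simp only [pauliChannel, Matrix.mul_sum, Matrix.sum_mul, Matrix.mul_smul, Matrix.smul_mul]
  refine Finset.sum_congr rfl fun p _ => Finset.sum_congr rfl fun q _ => ?_
  obtain ⟨s, hs, hsB⟩ := hB p
  obtain ⟨t, ht, htC⟩ := hC q
  have hst : (s * t) * star (s * t) = 1 := by
    rw [star_mul', mul_mul_mul_comm, hs, ht, one_mul]
  have hK : (B ⊗ₖ C)ᴴ * (pauli p ⊗ₖ pauli q) * (B ⊗ₖ C) =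
      (s * t) • (pauli (f p) ⊗ₖ pauli (g q)) := by
    rw [conjTranspose_kronecker, ← mul_kronecker_mul, ← mul_kronecker_mul, hsB, htC,
      smul_kronecker, kronecker_smul, smul_smul]
  congr 1
  calc (B ⊗ₖ C)ᴴ * ((pauli p ⊗ₖ pauli q) * ((B ⊗ₖ C) * ρ * (B ⊗ₖ C)ᴴ) *
          (pauli p ⊗ₖ pauli q)ᴴ) * (B ⊗ₖ C)
      = ((B ⊗ₖ C)ᴴ * (pauli p ⊗ₖ pauli q) * (B ⊗ₖ C)) * ρ *
          ((B ⊗ₖ C)ᴴ * (pauli p ⊗ₖ pauli q) * (B ⊗ₖ C))ᴴ := by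
        simp only [conjTranspose_mul, conjTranspose_conjTranspose, Matrix.mul_assoc]
    _ = _ := by
        rw [hK, conjTranspose_smul, Matrix.smul_mul, Matrix.smul_mul, Matrix.mul_smul, smul_smul,
          hst, one_smul]

/-- Averaging over the Pauli permutations on both qubits replaces `a` by `twirledCoef a`. -/
theorem sum_pauliPerm_smul {M : Type*} [AddCommGroup M] [Module ℂ M] (a : Fin 4 → Fin 4 → ℝ)
    (K : Fin 4 → Fin 4 → M) :
    ∑ i, ∑ j, ∑ p, ∑ q, (a p q : ℂ) • K (pauliPerm i p) (pauliPerm j q) =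
      (36 : ℂ) • ∑ p, ∑ q, (twirledCoef a p q : ℂ) • K p q := by
  have h (p q : Fin 4) : ∑ i, ∑ j, K (pauliPerm i p) (pauliPerm j q) =
      if p = 0 then (6 : ℂ) • (if q = 0 then (6 : ℂ) • K 0 0
        else (2 : ℂ) • (K 0 1 + K 0 2 + K 0 3))
      else (2 : ℂ) • ∑ r : Fin 3, (if q = 0 then (6 : ℂ) • K r.succ 0
        else (2 : ℂ) • (K r.succ 1 + K r.succ 2 + K r.succ 3)) := by
    simp only [sum_pauliPerm (K _)]
    rw [sum_pauliPerm fun r => if q = 0 then (6 : ℂ) • K r 0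
      else (2 : ℂ) • (K r 1 + K r 2 + K r 3), Fin.sum_univ_three]
    rfl
  calc ∑ i, ∑ j, ∑ p, ∑ q, (a p q : ℂ) • K (pauliPerm i p) (pauliPerm j q)
      = ∑ p, ∑ q, (a p q : ℂ) • ∑ i, ∑ j, K (pauliPerm i p) (pauliPerm j q) := by
        simp only [Finset.smul_sum]
        simp_rw [Finset.sum_comm (s := (Finset.univ : Finset (Fin 6)))
          (t := (Finset.univ : Finset (Fin 4)))]
    _ = _ := by
        simp only [h]
        simp [Fin.sum_univ_succ, twirledCoef]
        module

/-- **Localized Clifford Twirling.** The localized Clifford twirl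
`T(ρ) = (1/36) Σ_{B,B' ∈ 𝓑} (B⊗B')† N((B⊗B') ρ (B⊗B')†) (B⊗B')` of a two-qubit Pauli
channel `N` with coefficients `a` is the two-qubit Pauli channel with coefficients `a'`. -/
theorem localized_clifford_twirl_of_pauli_channel (a : Fin 4 → Fin 4 → ℝ)
    (ha : ∀ p q, 0 ≤ a p q) (hsum : ∑ p : Fin 4, ∑ q : Fin 4, a p q = 1)
    (ρ : Matrix (Fin 2 × Fin 2) (Fin 2 × Fin 2) ℂ) :
    ((36 : ℂ))⁻¹ • ∑ i : Fin 6, ∑ j : Fin 6,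
        (Bset i ⊗ₖ Bset j)ᴴ *
          pauliChannel a ((Bset i ⊗ₖ Bset j) * ρ * (Bset i ⊗ₖ Bset j)ᴴ) *
          (Bset i ⊗ₖ Bset j)
      = pauliChannel (twirledCoef a) ρ := by
  have h : ∀ i j, _ := fun i j =>
    (permutesPaulis_Bset i).conj_pauliChannel (permutesPaulis_Bset j) a ρ
  simp only [h]
  rw [sum_pauliPerm_smul a fun p q => (pauli p ⊗ₖ pauli q) * ρ * (pauli p ⊗ₖ pauli q)ᴴ,
    smul_smul, inv_mul_cancel₀ (by norm_num), one_smul, pauliChannel]
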